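/- Suppose that to each Polish space E and each μ ∈ 𝓟(E) is assigned a function α(·|μ) : 𝓟(E) → [0,∞] such that: (1) α(μ|μ) = 0; (2) α(ν|μ) = ∞ whenever ν ∈ 𝓟(E) is not absolutely continuous with respect to μ; (3) α(νK | μK) ≤ α(ν|μ) for every ν ∈ 𝓟(E) and every kernel K from E to any Polish space F. For each Polish space E, μ ∈ 𝓟(E), and bounded measurable f : E → ℝ define ρ_μ(f) := sup_{ν ∈ 𝓟(E)}(∫_E f dν − α(ν|μ)). Then each ρ_μ is a law invariant risk measure on L^∞(E,μ). Moreover, for any Polish spaces F and G, any μ ∈ 𝓟(F) and ν ∈ 𝓟(G), and any bounded measurable f : F → ℝ and g : G → ℝ with μ∘f⁻¹ = ν∘g⁻¹, one has ρ_μ(f) = ρ_ν(g). -/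

import Mathlib

open MeasureTheory ProbabilityTheory Filter Topology
open scoped ENNReal NNReal

noncomputable section

namespace RiskDiv

/-- A bounded measurable real-valued function (a representative of an element of `L^∞`). -/
def BddMeas {E : Type*} [MeasurableSpace E] (f : E → ℝ) : Prop :=
  Measurable f ∧ ∃ M : ℝ, ∀ x, |f x| ≤ M

/-- A (normalized, convex, monotone, cash-additive) risk measure on `L^∞(E, μ)`,
viewed as a functional on bounded measurable functions which respects a.e. equality. -/
structure IsRiskMeasure {E : Type*} [MeasurableSpace E] (μ : Measure E)
    (ρ : (E → ℝ) → ℝ) : Prop where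
  mono : ∀ f g : E → ℝ, BddMeas f → BddMeas g → (∀ᵐ x ∂μ, f x ≤ g x) → ρ f ≤ ρ g
  cash : ∀ (f : E → ℝ) (c : ℝ), BddMeas f → ρ (fun x => f x + c) = ρ f + c
  norm0 : ρ (fun _ => 0) = 0
  cvx : ∀ (f g : E → ℝ) (t : ℝ), BddMeas f → BddMeas g → 0 ≤ t → t ≤ 1 →
    ρ (fun x => t * f x + (1 - t) * g x) ≤ t * ρ f + (1 - t) * ρ g
  congr_ae : ∀ f g : E → ℝ, BddMeas f → BddMeas g → (∀ᵐ x ∂μ, f x = g x) → ρ f = ρ g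

/-- Law invariance: `ρ` only depends on the distribution of its argument. -/
def LawInvariant {E : Type*} [MeasurableSpace E] (μ : Measure E) (ρ : (E → ℝ) → ℝ) : Prop :=
  ∀ f g : E → ℝ, BddMeas f → BddMeas g → μ.map f = μ.map g → ρ f = ρ g

open Classical in
/-- `ρ_μ(f) := ρ(f ∘ X)` where `X` is any random variable with law `μ` (this is well defined,
independently of the choice of `X`, when `ρ` is law invariant). -/
def rhoMu {Ω : Type*} [MeasurableSpace Ω] (P : Measure Ω) (ρ : (Ω → ℝ) → ℝ)
    {E : Type*} [MeasurableSpace E] (μ : Measure E) (f : E → ℝ) : ℝ :=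
  if h : ∃ X : Ω → E, Measurable X ∧ P.map X = μ then ρ (f ∘ h.choose) else 0

/-- The divergence induced by `ρ`:
`α(ν|μ) := sup { ∫ f dν − ρ_μ(f) : f bounded measurable } ∈ [0,∞]`. -/
def divergence {Ω : Type*} [MeasurableSpace Ω] (P : Measure Ω) (ρ : (Ω → ℝ) → ℝ)
    {E : Type*} [MeasurableSpace E] (ν μ : Measure E) : ℝ≥0∞ :=
  ⨆ (f : E → ℝ) (_ : BddMeas f), ENNReal.ofReal ((∫ x, f x ∂ν) - rhoMu P ρ μ f)

/-- The divergence induced by `ρ` is simplified if, on `[0,1]`, the supremum defining it can be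
restricted to continuous functions. -/
def Simplified {Ω : Type*} [MeasurableSpace Ω] (P : Measure Ω) (ρ : (Ω → ℝ) → ℝ) : Prop :=
  ∀ μ ν : Measure (Set.Icc (0:ℝ) 1), IsProbabilityMeasure μ → IsProbabilityMeasure ν →
    divergence P ρ ν μ =
      ⨆ (f : (Set.Icc (0:ℝ) 1) → ℝ) (_ : Continuous f),
        ENNReal.ofReal ((∫ x, f x ∂ν) - rhoMu P ρ μ f)

/-- The risk measure `ρ_μ(f) := sup_{ν ∈ 𝓟(E)} (∫ f dν − α(ν|μ))` induced by a divergence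
functional `α` on a fixed space `E`. -/
def rhoOfDiv {E : Type*} [MeasurableSpace E] (α : Measure E → Measure E → ℝ≥0∞)
    (μ : Measure E) (f : E → ℝ) : ℝ :=
  sSup {r : ℝ | ∃ ν : Measure E, IsProbabilityMeasure ν ∧ α ν μ ≠ ⊤ ∧
    r = (∫ x, f x ∂ν) - (α ν μ).toReal}

theorem BddMeas.integrable {E : Type*} [MeasurableSpace E] {f : E → ℝ} (hf : BddMeas f)
    (ν : Measure E) [IsProbabilityMeasure ν] : Integrable f ν := by
  obtain ⟨hm, M, hM⟩ := hf
  exact Integrable.of_bound hm.aestronglyMeasurable M (Eventually.of_forall hM)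

theorem le_rho {E : Type*} [MeasurableSpace E] (α : Measure E → Measure E → ℝ≥0∞)
    (μ : Measure E) {f : E → ℝ} (hf : BddMeas f) (ν : Measure E) (hν : IsProbabilityMeasure ν)
    (h : α ν μ ≠ ⊤) : (∫ x, f x ∂ν) - (α ν μ).toReal ≤ rhoOfDiv α μ f := by
  apply le_csSup
  · obtain ⟨hm, M, hM⟩ := id hf
    refine ⟨M, ?_⟩
    rintro r ⟨ν', hν', -, rfl⟩
    have h1 : (∫ x, f x ∂ν') ≤ ∫ _, M ∂ν' :=
      integral_mono (hf.integrable ν') (integrable_const M) (fun x => (abs_le.1 (hM x)).2)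
    simp at h1
    have := ENNReal.toReal_nonneg (a := α ν' μ)
    linarith
  · exact ⟨ν, hν, h, rfl⟩

theorem rho_le {E : Type*} [MeasurableSpace E] (α : Measure E → Measure E → ℝ≥0∞)
    (μ : Measure E) (hμ : IsProbabilityMeasure μ) (h0 : α μ μ = 0) (f : E → ℝ) (c : ℝ)
    (h : ∀ ν : Measure E, IsProbabilityMeasure ν → α ν μ ≠ ⊤ →
      (∫ x, f x ∂ν) - (α ν μ).toReal ≤ c) : rhoOfDiv α μ f ≤ c := by
  apply csSup_le
  · exact ⟨_, μ, hμ, by simp [h0], rfl⟩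
  · rintro r ⟨ν', hν', h', rfl⟩
    exact h ν' hν' h'

theorem exists_ker {F G : Type} [MeasurableSpace F]
    [TopologicalSpace G] [MeasurableSpace G] [PolishSpace G] [BorelSpace G]
    (μ : Measure F) (ν : Measure G) (hμ : IsProbabilityMeasure μ) (hν : IsProbabilityMeasure ν)
    (f : F → ℝ) (g : G → ℝ) (hf : BddMeas f) (hg : BddMeas g) (h : μ.map f = ν.map g) :
    ∃ K : Kernel F G, IsMarkovKernel K ∧ μ.bind (fun x => K x) = ν ∧
      ∀ᵐ x ∂μ, ∀ᵐ z ∂(K x), g z = f x := by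
  haveI : Nonempty G := nonempty_of_isProbabilityMeasure ν
  have hf1 := hf.1
  have hg1 := hg.1
  let C := condDistrib (id : G → G) g ν
  have hC : (ν.map g) ⊗ₘ C = ν.map (fun a => (g a, a)) :=
    compProd_map_condDistrib (Y := (id : G → G)) (X := g) (μ := ν) aemeasurable_id
  refine ⟨C.comap f hf1, inferInstance, ?_, ?_⟩
  · have e1 : (ν.map g).bind C = ν := by
      rw [← Measure.snd_compProd, hC, Measure.snd, Measure.map_map measurable_snd (by fun_prop)]
      exact Measure.map_id
    have e2 : (μ.map f).bind C = μ.bind (fun x => C.comap f hf1 x) := by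
      ext s hs
      rw [Measure.bind_apply hs C.measurable.aemeasurable,
        Measure.bind_apply hs (C.comap f hf1).measurable.aemeasurable,
        lintegral_map (C.measurable_coe hs) hf1]
      rfl
    rw [← e2, h, e1]
  · have hms : MeasurableSet {p : ℝ × G | g p.2 = p.1} :=
      measurableSet_eq_fun (by fun_prop) (by fun_prop)
    have a1 : ∀ᵐ p ∂((ν.map g) ⊗ₘ C), g p.2 = p.1 := by
      rw [hC, ae_map_iff (by fun_prop) hms]
      simp
    have a2 := Measure.ae_ae_of_ae_compProd a1
    rw [← h] at a2
    exact ae_of_ae_map hf1.aemeasurable a2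

theorem rho_mono
    (α : ∀ (E : Type) [TopologicalSpace E] [MeasurableSpace E],
      Measure E → Measure E → ℝ≥0∞)
    (h1 : ∀ (E : Type) [TopologicalSpace E] [MeasurableSpace E] [PolishSpace E] [BorelSpace E]
      (μ : Measure E), IsProbabilityMeasure μ → α E μ μ = 0)
    (h2 : ∀ (E : Type) [TopologicalSpace E] [MeasurableSpace E] [PolishSpace E] [BorelSpace E]
      (μ ν : Measure E), IsProbabilityMeasure μ → IsProbabilityMeasure ν →
      ¬ ν ≪ μ → α E ν μ = ⊤)
    (h3 : ∀ (E : Type) [TopologicalSpace E] [MeasurableSpace E] [PolishSpace E] [BorelSpace E]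
      (F : Type) [TopologicalSpace F] [MeasurableSpace F] [PolishSpace F] [BorelSpace F]
      (μ ν : Measure E), IsProbabilityMeasure μ → IsProbabilityMeasure ν →
      ∀ (K : Kernel E F), IsMarkovKernel K →
        α F (ν.bind (fun x => K x)) (μ.bind (fun x => K x)) ≤ α E ν μ)
    (F : Type) [TopologicalSpace F] [MeasurableSpace F] [PolishSpace F] [BorelSpace F]
    (G : Type) [TopologicalSpace G] [MeasurableSpace G] [PolishSpace G] [BorelSpace G]
    (μ : Measure F) (ν : Measure G) (hμ : IsProbabilityMeasure μ) (hν : IsProbabilityMeasure ν)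
    (f : F → ℝ) (g : G → ℝ) (hf : BddMeas f) (hg : BddMeas g) (h : μ.map f = ν.map g) :
    rhoOfDiv (α F) μ f ≤ rhoOfDiv (α G) ν g := by
  apply rho_le _ _ hμ (h1 F μ hμ)
  intro ν' hν' hfin
  have hac : ν' ≪ μ := by
    by_contra hn
    exact hfin (h2 F μ ν' hμ hν' hn)
  obtain ⟨K, hK, hKμ, hae⟩ := exists_ker μ ν hμ hν f g hf hg h
  have hle := h3 F G μ ν' hμ hν' K hK
  rw [hKμ] at hle
  have hp : IsProbabilityMeasure (ν'.bind (fun x => K x)) :=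
    inferInstanceAs (IsProbabilityMeasure (ν'.bind K))
  have hfin2 := ne_top_of_le_ne_top hfin hle
  have key := le_rho (α G) ν hg _ hp hfin2
  have hint : ∫ z, g z ∂(ν'.bind (fun x => K x)) = ∫ x, f x ∂ν' := by
    have : ∫ z, g z ∂(ν'.bind K) = ∫ x, ∫ z, g z ∂(K x) ∂ν' := by
      rw [← Measure.snd_compProd, Measure.snd,
        integral_map measurable_snd.aemeasurable hg.1.aestronglyMeasurable,
        Measure.integral_compProd]
      exact BddMeas.integrable ⟨hg.1.comp measurable_snd, hg.2.imp fun M hM x => hM x.2⟩ _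
    refine this.trans (integral_congr_ae ?_)
    filter_upwards [hac.ae_le hae] with x hx
    rw [integral_congr_ae hx]
    simp
  have := ENNReal.toReal_mono hfin hle
  rw [hint] at key
  linarith

/-- If a family `α(·|·)`, defined for pairs of Borel probability measures on
every Polish space, satisfies `α(μ|μ) = 0`, `α(ν|μ) = ∞` when `ν` is not absolutely continuous
with respect to `μ`, and the data processing inequality `α(νK|μK) ≤ α(ν|μ)` for all Markov
kernels `K`, then each `ρ_μ(f) := sup_ν (∫ f dν − α(ν|μ))` is a law invariant risk measure on
`L^∞(E,μ)`, and the family is consistent: `ρ_μ(f) = ρ_ν(g)` whenever `μ ∘ f⁻¹ = ν ∘ g⁻¹`. -/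
theorem statement2
    (α : ∀ (E : Type) [TopologicalSpace E] [MeasurableSpace E],
      Measure E → Measure E → ℝ≥0∞)
    (h1 : ∀ (E : Type) [TopologicalSpace E] [MeasurableSpace E] [PolishSpace E] [BorelSpace E]
      (μ : Measure E), IsProbabilityMeasure μ → α E μ μ = 0)
    (h2 : ∀ (E : Type) [TopologicalSpace E] [MeasurableSpace E] [PolishSpace E] [BorelSpace E]
      (μ ν : Measure E), IsProbabilityMeasure μ → IsProbabilityMeasure ν →
      ¬ ν ≪ μ → α E ν μ = ⊤)
    (h3 : ∀ (E : Type) [TopologicalSpace E] [MeasurableSpace E] [PolishSpace E] [BorelSpace E]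
      (F : Type) [TopologicalSpace F] [MeasurableSpace F] [PolishSpace F] [BorelSpace F]
      (μ ν : Measure E), IsProbabilityMeasure μ → IsProbabilityMeasure ν →
      ∀ (K : Kernel E F), IsMarkovKernel K →
        α F (ν.bind (fun x => K x)) (μ.bind (fun x => K x)) ≤ α E ν μ) :
    (∀ (E : Type) [TopologicalSpace E] [MeasurableSpace E] [PolishSpace E] [BorelSpace E]
      (μ : Measure E), IsProbabilityMeasure μ →
        IsRiskMeasure μ (rhoOfDiv (α E) μ) ∧ LawInvariant μ (rhoOfDiv (α E) μ)) ∧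
    (∀ (F : Type) [TopologicalSpace F] [MeasurableSpace F] [PolishSpace F] [BorelSpace F]
      (G : Type) [TopologicalSpace G] [MeasurableSpace G] [PolishSpace G] [BorelSpace G]
      (μ : Measure F) (ν : Measure G), IsProbabilityMeasure μ → IsProbabilityMeasure ν →
      ∀ (f : F → ℝ) (g : G → ℝ), BddMeas f → BddMeas g → μ.map f = ν.map g →
        rhoOfDiv (α F) μ f = rhoOfDiv (α G) ν g) := by
  have hL := rho_mono α h1 h2 h3
  have hC : ∀ (F : Type) [TopologicalSpace F] [MeasurableSpace F] [PolishSpace F] [BorelSpace F]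
      (G : Type) [TopologicalSpace G] [MeasurableSpace G] [PolishSpace G] [BorelSpace G]
      (μ : Measure F) (ν : Measure G), IsProbabilityMeasure μ → IsProbabilityMeasure ν →
      ∀ (f : F → ℝ) (g : G → ℝ), BddMeas f → BddMeas g → μ.map f = ν.map g →
        rhoOfDiv (α F) μ f = rhoOfDiv (α G) ν g := by
    intro F _ _ _ _ G _ _ _ _ μ ν hμ hν f g hf hg h
    exact le_antisymm (hL F G μ ν hμ hν f g hf hg h) (hL G F ν μ hν hμ g f hg hf h.symm)
  refine ⟨?_, hC⟩
  intro E _ _ _ _ μ hμ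
  refine ⟨?_, fun f g hf hg h => hC E E μ μ hμ hμ f g hf hg h⟩
  have h0 := h1 E μ hμ
  have hmono : ∀ f g : E → ℝ, BddMeas f → BddMeas g → (∀ᵐ x ∂μ, f x ≤ g x) →
      rhoOfDiv (α E) μ f ≤ rhoOfDiv (α E) μ g := by
    intro f g hf hg h
    apply rho_le _ _ hμ h0
    intro ν hν hfin
    have hac : ν ≪ μ := by
      by_contra hn
      exact hfin (h2 E μ ν hμ hν hn)
    have k := le_rho (α E) μ hg ν hν hfin
    have : ∫ x, f x ∂ν ≤ ∫ x, g x ∂ν :=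
      integral_mono_ae (hf.integrable ν) (hg.integrable ν) (hac.ae_le h)
    linarith
  have hadd : ∀ (f : E → ℝ) (c : ℝ), BddMeas f → BddMeas (fun x => f x + c) := by
    rintro f c ⟨hm, M, hM⟩
    exact ⟨hm.add_const c, M + |c|, fun x => (abs_add_le _ _).trans (by linarith [hM x])⟩
  have hcash : ∀ (f : E → ℝ) (c : ℝ), BddMeas f →
      rhoOfDiv (α E) μ (fun x => f x + c) ≤ rhoOfDiv (α E) μ f + c := by
    intro f c hf
    apply rho_le _ _ hμ h0
    intro ν hν hfin
    have k := le_rho (α E) μ hf ν hν hfin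
    have : ∫ x, (f x + c) ∂ν = (∫ x, f x ∂ν) + c := by
      rw [integral_add (hf.integrable ν) (integrable_const c)]
      simp
    linarith
  constructor
  · exact hmono
  · intro f c hf
    apply le_antisymm (hcash f c hf)
    have := hcash (fun x => f x + c) (-c) (hadd f c hf)
    simp only [add_neg_cancel_right] at this
    change rhoOfDiv (α E) μ f ≤ _ at this
    linarith
  · apply le_antisymm
    · apply rho_le _ _ hμ h0
      intro ν hν hfin
      simp
    · have := le_rho (α E) μ (f := fun _ => 0) ⟨measurable_const, 0, by simp⟩ μ hμ (by simp [h0])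
      simpa [h0] using this
  · intro f g t hf hg ht ht1
    apply rho_le _ _ hμ h0
    intro ν hν hfin
    have k1 := le_rho (α E) μ hf ν hν hfin
    have k2 := le_rho (α E) μ hg ν hν hfin
    rw [integral_add ((hf.integrable ν).const_mul t) ((hg.integrable ν).const_mul (1 - t)),
      integral_const_mul, integral_const_mul]
    nlinarith [mul_le_mul_of_nonneg_left k1 ht,
      mul_le_mul_of_nonneg_left k2 (sub_nonneg.2 ht1)]
  · intro f g hf hg h
    exact le_antisymm (hmono f g hf hg (h.mono fun x hx => hx.le))
      (hmono g f hg hf (h.mono fun x hx => hx.ge))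

end RiskDiv
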